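/- arXiv:2203.04065 — 2 statements merged into one kernel-verified Lean document; each statement's English description precedes it below -/
import Mathlib

section
/- For arbitrary q ∈ [0,1], ξ ∈ (0,1) and γ > 0, the inequality K(q,ξ) ≤ γ implies |ξ − q| ≤ sqrt( 2γ q (1 − q) ) + |1 − 2q| γ. -/
/-- `K(q, ξ) = q log(q/ξ) + (1 - q) log{(1 - q)/(1 - ξ)}`. Note that Lean's convention
`Real.log 0 = 0` implements the convention `0 log 0 := 0` for `q ∈ {0, 1}` and
`ξ ∈ (0, 1)`. -/
noncomputable def Kfun (q ξ : ℝ) : ℝ :=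
  q * Real.log (q / ξ) + (1 - q) * Real.log ((1 - q) / (1 - ξ))

theorem Kfun_one_sub (q ξ : ℝ) : Kfun (1 - q) (1 - ξ) = Kfun q ξ := by
  simp only [Kfun, sub_sub_cancel]
  ring

theorem Kfun_self {q : ℝ} (hq : 0 < q) (hq' : q < 1) : Kfun q q = 0 := by
  have h : 1 - q ≠ 0 := by linarith
  simp [Kfun, hq.ne', h]

theorem hasDerivAt_Kfun {q ξ : ℝ} (hq : 0 < q) (hq' : q < 1) (hξ : 0 < ξ) (hξ' : ξ < 1) :
    HasDerivAt (Kfun q) ((ξ - q) / (ξ * (1 - ξ))) ξ := by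
  have h1 : 1 - q ≠ 0 := by linarith
  have h2 : 1 - ξ ≠ 0 := by linarith
  have hd1 : HasDerivAt (fun x : ℝ => q / x) (-q / ξ ^ 2) ξ := by
    simpa using (hasDerivAt_const ξ q).fun_div (hasDerivAt_id ξ) hξ.ne'
  have hd2 : HasDerivAt (fun x : ℝ => (1 - q) / (1 - x)) ((1 - q) / (1 - ξ) ^ 2) ξ := by
    simpa using (hasDerivAt_const ξ (1 - q)).fun_div ((hasDerivAt_id ξ).const_sub 1) h2
  have h := ((hd1.log (div_ne_zero hq.ne' hξ.ne')).const_mul q).fun_add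
    ((hd2.log (div_ne_zero h1 h2)).const_mul (1 - q))
  refine h.congr_deriv ?_
  field_simp
  ring

/-- A lower bound for `K` along the quadratic curve `t ↦ q + a (t + b t² / 2)`, `a = q (1 - q)`. -/
theorem quadratic_le_Kfun {q b T : ℝ} (hq : 0 < q) (hq' : q < 1) (hb : 0 ≤ b)
    (hqb : 1 - 2 * q ≤ b) (hT : 0 ≤ T)
    (hT' : q + q * (1 - q) * (T + b * T ^ 2 / 2) < 1) :
    q * (1 - q) * T ^ 2 / 2 ≤ Kfun q (q + q * (1 - q) * (T + b * T ^ 2 / 2)) := by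
  have ha : 0 < q * (1 - q) := mul_pos hq (by linarith)
  set a := q * (1 - q) with ha_def
  have hder : ∀ t ∈ Set.Icc 0 T, HasDerivAt
      (fun t => Kfun q (q + a * (t + b * t ^ 2 / 2)) - a * t ^ 2 / 2)
      (a * (t + b * t ^ 2 / 2) / ((q + a * (t + b * t ^ 2 / 2)) *
        (1 - (q + a * (t + b * t ^ 2 / 2)))) * (a * (1 + b * t)) - a * t) t ∧
      0 < q + a * (t + b * t ^ 2 / 2) ∧ q + a * (t + b * t ^ 2 / 2) < 1 := by
    rintro t ⟨ht, htT⟩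
    have hpos : 0 < q + a * (t + b * t ^ 2 / 2) := by positivity
    have hlt : q + a * (t + b * t ^ 2 / 2) < 1 := lt_of_le_of_lt (by gcongr) hT'
    refine ⟨?_, hpos, hlt⟩
    have hc : HasDerivAt (fun t : ℝ => q + a * (t + b * t ^ 2 / 2)) (a * (1 + b * t)) t := by
      have h := ((((hasDerivAt_id t).fun_add
        (((hasDerivAt_pow 2 t).const_mul b).div_const 2)).const_mul a).const_add q)
      refine h.congr_deriv ?_
      push_cast
      ring
    have hs : HasDerivAt (fun t : ℝ => a * t ^ 2 / 2) (a * t) t := by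
      refine (((hasDerivAt_pow 2 t).const_mul a).div_const 2).congr_deriv ?_
      push_cast
      ring
    have h := ((hasDerivAt_Kfun hq hq' hpos hlt).comp t hc).fun_sub hs
    rw [add_sub_cancel_left] at h
    exact h
  have hmono : MonotoneOn (fun t => Kfun q (q + a * (t + b * t ^ 2 / 2)) - a * t ^ 2 / 2)
      (Set.Icc 0 T) := by
    refine monotoneOn_of_hasDerivWithinAt_nonneg (convex_Icc 0 T)
      (fun t ht => (hder t ht).1.continuousAt.continuousWithinAt)
      (fun t ht => (hder t (interior_subset ht)).1.hasDerivWithinAt) ?_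
    intro t ht
    have ht := interior_subset ht
    obtain ⟨-, hpos, hlt⟩ := hder t ht
    have ht0 : 0 ≤ t := ht.1
    set δ := a * (t + b * t ^ 2 / 2) with hδ_def
    have hδ : 0 ≤ δ := by positivity
    have hδt : a * t ≤ δ := by
      have : 0 ≤ a * (b * t ^ 2 / 2) := by positivity
      linarith [mul_add a t (b * t ^ 2 / 2)]
    have hvar : (q + δ) * (1 - (q + δ)) ≤ a + b * δ := by
      nlinarith [mul_le_mul_of_nonneg_right hqb hδ, sq_nonneg δ]
    have hprod : 0 < (q + δ) * (1 - (q + δ)) := mul_pos hpos (by linarith)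
    rw [sub_nonneg, div_mul_eq_mul_div, le_div_iff₀ hprod]
    calc a * t * ((q + δ) * (1 - (q + δ))) ≤ a * t * (a + b * δ) := by gcongr
      _ = a * (a * t) + a * δ * (b * t) := by ring
      _ ≤ a * δ + a * δ * (b * t) := by gcongr
      _ = δ * (a * (1 + b * t)) := by ring
  have h := hmono (Set.left_mem_Icc.2 hT) (Set.right_mem_Icc.2 hT) hT
  simp only [ne_eq, OfNat.ofNat_ne_zero, not_false_eq_true, zero_pow, mul_zero, zero_div,
    add_zero, sub_zero, Kfun_self hq hq'] at h
  linarith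

theorem sub_le_of_Kfun_le {q ξ γ : ℝ} (hq : 0 ≤ q) (hξ : ξ < 1) (hqξ : q ≤ ξ)
    (hK : Kfun q ξ ≤ γ) :
    ξ - q ≤ √(2 * γ * q * (1 - q)) + |1 - 2 * q| * γ := by
  rcases hq.eq_or_lt with rfl | hq
  · have h := Real.log_le_sub_one_of_pos (show 0 < 1 - ξ by linarith)
    simp only [Kfun, zero_mul, sub_zero, one_mul, zero_add, one_div, Real.log_inv] at hK
    simp
    linarith
  have hq' : q < 1 := hqξ.trans_lt hξ
  have ha : 0 < q * (1 - q) := mul_pos hq (by linarith)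
  set b := |1 - 2 * q|
  have hb : 0 ≤ b := abs_nonneg _
  have hT₀ : 0 ≤ (ξ - q) / (q * (1 - q)) := div_nonneg (by linarith) ha.le
  obtain ⟨T, ⟨hT, -⟩, hTξ⟩ := intermediate_value_Icc hT₀
    (f := fun t => q * (1 - q) * (t + b * t ^ 2 / 2)) (by fun_prop)
    (show ξ - q ∈ Set.Icc _ _ by
      refine ⟨by simpa using hqξ, ?_⟩
      have : 0 ≤ q * (1 - q) * (b * ((ξ - q) / (q * (1 - q))) ^ 2 / 2) := by positivity
      simp only [mul_add]
      rw [mul_div_cancel₀ _ ha.ne']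
      linarith)
  simp only at hTξ
  have hξT : q + q * (1 - q) * (T + b * T ^ 2 / 2) = ξ := by linarith
  have hle := quadratic_le_Kfun hq hq' hb (le_abs_self _) hT (hξT.trans_lt hξ)
  rw [hξT] at hle
  have hγ : q * (1 - q) * T ^ 2 / 2 ≤ γ := hle.trans hK
  have hsqrt : q * (1 - q) * T ≤ √(2 * γ * q * (1 - q)) := by
    refine Real.le_sqrt_of_sq_le ?_
    linarith [mul_le_mul_of_nonneg_left hγ ha.le]
  linarith [mul_le_mul_of_nonneg_left hγ hb]

/-- **Lemma B3.** For arbitrary `q ∈ [0,1]`, `ξ ∈ (0,1)` and `γ > 0`, the inequality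
`K(q,ξ) ≤ γ` implies `|ξ - q| ≤ √(2γ q (1 - q)) + |1 - 2q| γ`. -/
theorem kl_divergence_quadratic_bound
    (q ξ γ : ℝ) (hq : q ∈ Set.Icc (0 : ℝ) 1) (hξ : ξ ∈ Set.Ioo (0 : ℝ) 1)
    (hγ : 0 < γ) (hK : Kfun q ξ ≤ γ) :
    |ξ - q| ≤ Real.sqrt (2 * γ * q * (1 - q)) + |1 - 2 * q| * γ := by
  rcases le_total q ξ with h | h
  · rw [abs_of_nonneg (sub_nonneg.2 h)]
    exact sub_le_of_Kfun_le hq.1 hξ.2 h hK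
  · rw [abs_of_nonpos (sub_nonpos.2 h)]
    have := sub_le_of_Kfun_le (q := 1 - q) (ξ := 1 - ξ) (by linarith [hq.2])
      (by linarith [hξ.1]) (by linarith) ((Kfun_one_sub q ξ).trans_le hK)
    rw [show 2 * γ * (1 - q) * (1 - (1 - q)) = 2 * γ * q * (1 - q) by ring,
      show 1 - 2 * (1 - q) = -(1 - 2 * q) by ring, abs_neg] at this
    linarith
end

section
/- Let x_1 ≤ … ≤ x_n be real covariates, Y_1, …, Y_n ∈ {0,1}, and p̂ the isotonic least-squares fit. For any pair (j,k) ∈ J such that either p̂(x_k) < p̂(x_{k+1}) or k = n, it holds that Z_{jk} ≤ Z^{iso}_{jk}, i.e. Σ_{i=j}^k Y_i ≤ Σ_{i=j}^k p̂(x_i). -/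
open Finset

/-- The set `J` of index pairs `(j,k)` with `j ≤ k`, `x_{j-1} < x_j` and `x_k < x_{k+1}`
(the boundary conditions being vacuous for the extreme indices, i.e. `x_0 = -∞`,
`x_{n+1} = ∞`). -/
def idxJ (n : ℕ) (x : Fin n → ℝ) : Set (Fin n × Fin n) :=
  {jk | jk.1 ≤ jk.2 ∧ (∀ i : Fin n, (i : ℕ) + 1 = (jk.1 : ℕ) → x i < x jk.1) ∧
    (∀ i : Fin n, (jk.2 : ℕ) + 1 = (i : ℕ) → x jk.2 < x i)}

/-- An isotonic function `phat : ℝ → [0,1]` minimizing `Σ (h(x_i) - Y_i)²` over all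
isotonic functions `h : ℝ → [0,1]` (the isotonic least-squares fit). -/
def IsIsoFit01 (n : ℕ) (x : Fin n → ℝ) (Y : Fin n → ℝ) (phat : ℝ → ℝ) : Prop :=
  Monotone phat ∧ (∀ t, phat t ∈ Set.Icc (0 : ℝ) 1) ∧
    ∀ h : ℝ → ℝ, Monotone h → (∀ t, h t ∈ Set.Icc (0 : ℝ) 1) →
      ∑ i, (phat (x i) - Y i) ^ 2 ≤ ∑ i, (h (x i) - Y i) ^ 2

/-- First-order optimality of the isotonic fit: if the fitted values on the index interval `[j, k]`
lie strictly below a level `M ≤ 1` (or equal `1`) and those beyond `k` are at least `M`, then the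
data cannot exceed the fit in total over `[j, k]`, since otherwise raising the fit slightly there
would decrease the squared error. -/
theorem IsIsoFit01.sum_sub_nonpos {n : ℕ} {x : Fin n → ℝ} {Y : Fin n → ℝ} {p : ℝ → ℝ}
    (hp : IsIsoFit01 n x Y p) (hx : Monotone x) (hY : ∀ i, Y i ≤ 1) {j k : Fin n}
    (hj : ∀ i, i < j → x i < x j) {M : ℝ} (hM : M ≤ 1)
    (hle : ∀ i, i ≤ k → p (x i) < M ∨ p (x i) = 1) (hgt : ∀ i, k < i → M ≤ p (x i)) :
    ∑ i ∈ Icc j k, (Y i - p (x i)) ≤ 0 := by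
  obtain ⟨hmono, hmem, hmin⟩ := hp
  by_contra! hS
  set S := ∑ i ∈ Icc j k, (Y i - p (x i)) with hSdef
  obtain ⟨ε, hε, hεM, hεS⟩ : ∃ ε : ℝ, 0 < ε ∧ (∀ i, p (x i) < M → p (x i) + ε < M) ∧
      (Icc j k).card * ε < 2 * S := by
    have small : ∀ a b c : ℝ, b < c → ∀ᶠ ε in nhdsWithin (0 : ℝ) (Set.Ioi 0), b + a * ε < c := by
      intro a b c hbc
      have hc : ContinuousAt (fun ε : ℝ => b + a * ε) 0 := by fun_prop
      exact (hc.eventually_lt continuousAt_const (by simpa using hbc)).filter_mono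
        nhdsWithin_le_nhds
    have h₁ : ∀ᶠ ε in nhdsWithin (0 : ℝ) (Set.Ioi 0), ∀ i, p (x i) < M → p (x i) + 1 * ε < M := by
      rw [Filter.eventually_all]
      intro i
      by_cases h : p (x i) < M
      · simpa [h] using small 1 _ _ h
      · simp [h]
    obtain ⟨ε, ⟨h₁, h₂⟩, h₃⟩ := ((h₁.and (small ((Icc j k).card : ℝ) 0 (2 * S) (by linarith))).and
      self_mem_nhdsWithin).exists
    exact ⟨ε, h₃, by simpa using h₁, by simpa using h₂⟩
  let h : ℝ → ℝ := fun t => if t < x j then p t else max (p t) (min (p t + ε) M)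
  have hh : Monotone h := by
    intro s t hst
    have hpst := hmono hst
    by_cases ht : t < x j
    · simpa [h, ht, hst.trans_lt ht] using hpst
    · by_cases hs : s < x j
      · simpa [h, hs, ht] using Or.inl hpst
      · simp only [h, hs, ht, if_false]
        gcongr
  have hh01 : ∀ t, h t ∈ Set.Icc (0 : ℝ) 1 := by
    intro t
    by_cases ht : t < x j
    · simpa [h, ht] using hmem t
    · simp only [h, ht, if_false]
      exact ⟨(hmem t).1.trans (le_max_left _ _),
        max_le (hmem t).2 ((min_le_right _ _).trans hM)⟩
  have hout : ∀ i, i ∉ Icc j k → h (x i) = p (x i) := by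
    intro i hi
    rw [mem_Icc, not_and_or, not_le, not_le] at hi
    by_cases hij : x i < x j
    · simp [h, hij]
    · have hki := hi.resolve_left fun hlt => hij (hj i hlt)
      simp [h, hij, hgt i hki]
  have hin : ∀ i ∈ Icc j k,
      (h (x i) - Y i) ^ 2 - (p (x i) - Y i) ^ 2 ≤ ε ^ 2 - 2 * ε * (Y i - p (x i)) := by
    intro i hi
    rw [mem_Icc] at hi
    have hij : ¬ x i < x j := not_lt.2 (hx hi.1)
    rcases hle i hi.2 with hlt | heq
    · have : h (x i) = p (x i) + ε := by
        simp [h, hij, min_eq_left (hεM i hlt).le, hε.le]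
      rw [this]
      linarith
    · have : h (x i) = p (x i) := by
        simp [h, hij, heq, hM]
      rw [this, heq]
      nlinarith [hY i]
  have hdiff : ∑ i, ((h (x i) - Y i) ^ 2 - (p (x i) - Y i) ^ 2) =
      ∑ i ∈ Icc j k, ((h (x i) - Y i) ^ 2 - (p (x i) - Y i) ^ 2) := by
    refine (sum_subset (subset_univ _) fun i _ hi => ?_).symm
    rw [hout i hi, sub_self]
  have hsum := sum_le_sum hin
  rw [← hdiff, sum_sub_distrib, sum_sub_distrib, ← mul_sum, ← hSdef, sum_const,
    nsmul_eq_mul] at hsum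
  nlinarith [hmin h hh hh01]

/-- **Inequality (B1).** For binary data `Y_1, …, Y_n ∈ {0,1}` with covariates
`x_1 ≤ … ≤ x_n` and isotonic least-squares fit `p̂`, any pair `(j,k) ∈ J` with
`p̂(x_k) < p̂(x_{k+1})` or `k = n` satisfies `Z_{jk} ≤ Z^{iso}_{jk}`, i.e.
`Σ_{i=j}^k Y_i ≤ Σ_{i=j}^k p̂(x_i)`. -/
theorem data_sum_le_iso_sum
    (n : ℕ) (x : Fin n → ℝ) (hx : Monotone x)
    (Y : Fin n → ℕ) (hY01 : ∀ i, Y i ≤ 1)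
    (phat : ℝ → ℝ) (hphat : IsIsoFit01 n x (fun i => (Y i : ℝ)) phat)
    (jk : Fin n × Fin n) (hjk : jk ∈ idxJ n x)
    (hend : (jk.2 : ℕ) + 1 = n ∨
      ∃ k' : Fin n, (k' : ℕ) = (jk.2 : ℕ) + 1 ∧ phat (x jk.2) < phat (x k')) :
    ((∑ i ∈ Finset.Icc jk.1 jk.2, Y i : ℕ) : ℝ) ≤ ∑ i ∈ Finset.Icc jk.1 jk.2, phat (x i) := by
  obtain ⟨j, k⟩ := jk
  obtain ⟨-, hleft, -⟩ := hjk
  have hmono := hphat.1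
  have hmem := hphat.2.1
  dsimp only at hleft hend ⊢
  have hj : ∀ i, i < j → x i < x j := by
    intro i hi
    have hlt : (i : ℕ) < j := hi
    let i' : Fin n := ⟨j - 1, by omega⟩
    have hii' : i ≤ i' := by
      rw [Fin.le_def]
      simp only [i']
      omega
    exact (hx hii').trans_lt (hleft i' (by simp only [i']; omega))
  have hY : ∀ i, (Y i : ℝ) ≤ 1 := fun i => by exact_mod_cast hY01 i
  have key : ∑ i ∈ Icc j k, ((Y i : ℝ) - phat (x i)) ≤ 0 := by
    rcases hend with hk | ⟨k', hk', hlt⟩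
    · refine hphat.sum_sub_nonpos hx hY hj le_rfl (fun i _ => (hmem (x i)).2.lt_or_eq) ?_
      intro i hi
      have hki : (k : ℕ) < i := hi
      omega
    · refine hphat.sum_sub_nonpos hx hY hj (hmem (x k')).2
        (fun i hi => Or.inl ((hmono (hx hi)).trans_lt hlt)) ?_
      intro i hi
      have hki : (k : ℕ) < i := hi
      exact hmono (hx (Fin.le_def.2 (by omega)))
  rw [sum_sub_distrib, sub_nonpos] at key
  exact_mod_cast key
end
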